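/- arXiv:1803.02968 — 3 statements merged into one kernel-verified Lean document; each statement's English description precedes it below -/
import Mathlib

section
/- The symmetric matrix multiplication mapping M₊(W) = W·Wᵀ from ℝ^{n×k} to its range R_{M₊} = {Z ∈ ℝ^{n×n} : Z is symmetric positive semidefinite and rank(Z) ≤ min(n, k)} is an open mapping onto R_{M₊}: for every W ∈ ℝ^{n×k} and every ε > 0 there exists δ > 0 such that every symmetric positive semidefinite matrix Z̃ ∈ ℝ^{n×n} with rank(Z̃) ≤ min(n, k) and ‖Z̃ − W·Wᵀ‖ < δ can be written as Z̃ = W̃·W̃ᵀ for some W̃ ∈ ℝ^{n×k} with ‖W̃ − W‖ < ε. -/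
open Matrix

/-- Frobenius norm of a real matrix. -/
noncomputable def frob {m n : ℕ} (A : Matrix (Fin m) (Fin n) ℝ) : ℝ :=
  Real.sqrt (∑ i, ∑ j, (A i j) ^ 2)

open scoped Matrix.Norms.Frobenius

theorem frob_eq_norm {m n : ℕ} (A : Matrix (Fin m) (Fin n) ℝ) : frob A = ‖A‖ := by
  simp [frob, frobenius_norm_def, Real.sqrt_eq_rpow]

theorem frob_eq_sqrt_trace {m n : ℕ} (A : Matrix (Fin m) (Fin n) ℝ) :
    frob A = √(A * Aᵀ).trace := by
  simp [frob, trace, mul_apply, sq]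

theorem isProperMap_mul_transpose_self (m n : ℕ) :
    IsProperMap fun A : Matrix (Fin m) (Fin n) ℝ => A * Aᵀ := by
  have : ProperSpace (Matrix (Fin m) (Fin n) ℝ) := FiniteDimensional.proper_real _
  refine isProperMap_of_comp_of_t2 (g := fun Z : Matrix (Fin m) (Fin m) ℝ => √Z.trace)
    (by fun_prop) (by fun_prop) ?_
  have hcomp : (fun Z : Matrix (Fin m) (Fin m) ℝ => √Z.trace) ∘
      (fun A : Matrix (Fin m) (Fin n) ℝ => A * Aᵀ) = dist 0 := by
    ext A
    rw [dist_zero_left, ← frob_eq_norm]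
    exact (frob_eq_sqrt_trace A).symm
  rw [hcomp]
  exact isProperMap_dist _

/-- A linear map is determined up to an isometry of its codomain by the norms of its values. -/
theorem LinearMap.exists_linearIsometry_comp_eq {E F : Type*} [AddCommGroup E] [Module ℝ E]
    [NormedAddCommGroup F] [InnerProductSpace ℝ F] [FiniteDimensional ℝ F]
    {f g : E →ₗ[ℝ] F} (h : ∀ x, ‖f x‖ = ‖g x‖) :
    ∃ L : F →ₗᵢ[ℝ] F, ∀ x, L (f x) = g x := by
  obtain ⟨s, hs⟩ := f.rangeRestrict.exists_rightInverse_of_surjective f.range_rangeRestrict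
  have hfs (y : f.range) : f (s y) = y := congr_arg Subtype.val (LinearMap.congr_fun hs y)
  let L : f.range →ₗᵢ[ℝ] F := ⟨g ∘ₗ s, fun y => by simp [← h, hfs]⟩
  refine ⟨L.extend, fun x => ?_⟩
  rw [L.extend_apply ⟨f x, x, rfl⟩]
  change g (s ⟨f x, x, rfl⟩) = g x
  rw [← sub_eq_zero, ← map_sub, ← norm_eq_zero, ← h, map_sub, hfs, sub_self, norm_zero]

theorem norm_toLp_transpose_mulVec_sq {m n : ℕ} (A : Matrix (Fin m) (Fin n) ℝ) (x : Fin m → ℝ) :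
    ‖WithLp.toLp 2 (Aᵀ *ᵥ x)‖ ^ 2 = x ⬝ᵥ (A * Aᵀ) *ᵥ x := by
  rw [EuclideanSpace.real_norm_sq_eq, ← mulVec_mulVec, dotProduct_mulVec, ← mulVec_transpose]
  simp [dotProduct, sq]

theorem exists_orthogonal_of_mul_transpose_self_eq {m n : ℕ} {A B : Matrix (Fin m) (Fin n) ℝ}
    (h : A * Aᵀ = B * Bᵀ) : ∃ Q : Matrix (Fin n) (Fin n) ℝ, Q * Qᵀ = 1 ∧ A * Q = B := by
  obtain ⟨L, hL⟩ := LinearMap.exists_linearIsometry_comp_eq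
    (f := Aᵀ.toEuclideanLin) (g := Bᵀ.toEuclideanLin) fun x => by
      rw [← sq_eq_sq₀ (norm_nonneg _) (norm_nonneg _), toLpLin_apply, toLpLin_apply,
        norm_toLp_transpose_mulVec_sq, norm_toLp_transpose_mulVec_sq, h]
  obtain ⟨P, hP⟩ := toEuclideanLin.surjective L.toLinearMap
  have hPL (x) : P.toEuclideanLin x = L x := by rw [hP]; rfl
  refine ⟨Pᵀ, ?_, ?_⟩
  · ext i j
    have hij := L.inner_map_map (EuclideanSpace.single i 1) (EuclideanSpace.single j 1)
    rw [← hPL, ← hPL] at hij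
    simpa [toLpLin_apply, PiLp.inner_apply, mul_apply, one_apply, mul_comm, Pi.single_apply,
      eq_comm] using hij
  · apply transpose_injective
    rw [transpose_mul, transpose_transpose]
    apply toEuclideanLin.injective
    ext1 x
    rw [← hL, ← hPL]
    simp [toLpLin_apply, mulVec_mulVec]

theorem Matrix.PosSemidef.exists_eq_mul_transpose_of_rank_le {n k : ℕ}
    {Z : Matrix (Fin n) (Fin n) ℝ} (hZ : Z.PosSemidef) (hk : Z.rank ≤ k) :
    ∃ V : Matrix (Fin n) (Fin k) ℝ, Z = V * Vᵀ := by
  set d := hZ.1.eigenvalues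
  set U : Matrix (Fin n) (Fin n) ℝ := hZ.1.eigenvectorUnitary.1
  have hZU (a b) : Z a b = ∑ i, d i * (U a i * U b i) := by
    conv_lhs => rw [hZ.1.spectral_theorem]
    simp [Unitary.conjStarAlgAut_apply, mul_apply, diagonal_apply, U, d, star_apply]
    exact Finset.sum_congr rfl fun i _ => by ring
  rw [hZ.1.rank_eq_card_non_zero_eigs] at hk
  obtain ⟨e⟩ : Nonempty ({i // d i ≠ 0} ↪ Fin k) :=
    Function.Embedding.nonempty_of_card_le (by simpa using hk)
  let A : Matrix (Fin n) {i // d i ≠ 0} ℝ := of fun a i => √(d i) * U a i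
  let E : Matrix {i // d i ≠ 0} (Fin k) ℝ := of fun i j => if e i = j then 1 else 0
  have hE : E * Eᵀ = 1 := by
    ext i j
    simp [E, mul_apply, one_apply, e.injective.eq_iff, eq_comm]
  have hA : A * Aᵀ = Z := by
    ext a b
    rw [hZU, mul_apply]
    have (i : Fin n) : d i * (U a i * U b i) = √(d i) * U a i * (√(d i) * U b i) := by
      linear_combination -(U a i * U b i) * Real.mul_self_sqrt (hZ.eigenvalues_nonneg i)
    simp_rw [this]
    rw [← Fintype.sum_subtype_add_sum_subtype (fun i => d i ≠ 0)]
    have hzero : ∑ i : {i // ¬ d i ≠ 0}, √(d i) * U a i * (√(d i) * U b i) = 0 :=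
      Finset.sum_eq_zero fun i _ => by simp [not_not.1 i.2]
    simp [hzero, A]
  refine ⟨A * E, ?_⟩
  rw [transpose_mul, Matrix.mul_assoc, ← Matrix.mul_assoc E, hE, Matrix.one_mul, hA]

/-- The symmetric matrix multiplication mapping `M₊(W) = W * Wᵀ` is open onto its
range `{Z : Z symmetric PSD, rank Z ≤ min (n, k)}`: around every `W` and every `ε > 0` there is
`δ > 0` such that every PSD matrix of rank at most `min n k` at Frobenius distance less than `δ`
from `W * Wᵀ` factors as `W' * W'ᵀ` with `W'` at Frobenius distance less than `ε` from `W`. -/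
theorem statement_2 {n k : ℕ} (W : Matrix (Fin n) (Fin k) ℝ) :
    ∀ ε > 0, ∃ δ > 0, ∀ Z : Matrix (Fin n) (Fin n) ℝ,
      Z.PosSemidef → Z.rank ≤ min n k → frob (Z - W * Wᵀ) < δ →
        ∃ W' : Matrix (Fin n) (Fin k) ℝ, frob (W' - W) < ε ∧ Z = W' * W'ᵀ := by
  intro ε hε
  let C : Set (Matrix (Fin n) (Fin k) ℝ) :=
    {V | ∀ Q : Matrix (Fin k) (Fin k) ℝ, Q * Qᵀ = 1 → ε ≤ frob (V * Q - W)}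
  have hC : IsClosed C := by
    simp only [C, Set.ofPred_forall, frob_eq_norm]
    exact isClosed_iInter fun Q => isClosed_iInter fun _ =>
      isClosed_le continuous_const (by fun_prop)
  have hWC : W * Wᵀ ∉ (fun V : Matrix (Fin n) (Fin k) ℝ => V * Vᵀ) '' C := by
    rintro ⟨V, hV, hVW⟩
    obtain ⟨Q, hQ, rfl⟩ := exists_orthogonal_of_mul_transpose_self_eq hVW
    have := hV Q hQ
    simp [frob] at this
    linarith
  obtain ⟨δ, hδ, hball⟩ := Metric.isOpen_iff.1
    ((isProperMap_mul_transpose_self n k).isClosedMap C hC).isOpen_compl _ hWC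
  refine ⟨δ, hδ, fun Z hZ hrank hdist => ?_⟩
  obtain ⟨V, rfl⟩ := hZ.exists_eq_mul_transpose_of_rank_le (hrank.trans (min_le_right n k))
  have hVC : V ∉ C := fun hV =>
    hball (by rwa [Metric.mem_ball, dist_eq_norm, ← frob_eq_norm]) ⟨V, hV, rfl⟩
  simp only [C, Set.mem_ofPred_eq, not_forall, not_le] at hVC
  obtain ⟨Q, hQ, hlt⟩ := hVC
  refine ⟨V * Q, hlt, ?_⟩
  rw [transpose_mul, Matrix.mul_assoc, ← Matrix.mul_assoc Q, hQ, Matrix.one_mul]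
end

section
/- Let X ∈ ℝ^{d0×n} and Y ∈ ℝ^{d2×n} be arbitrary matrices. Every local minimum (W̄2, W̄1), with W̄2 ∈ ℝ^{d2×d1} and W̄1 ∈ ℝ^{d1×d0}, of the two-layer linear network objective f(W2, W1) = (1/2)·‖W2·W1·X − Y‖² is a global minimum of f. -/
open Matrix

theorem frob_sq {m n : ℕ} (A : Matrix (Fin m) (Fin n) ℝ) : frob A ^ 2 = trace (Aᵀ * A) := by
  rw [frob, Real.sq_sqrt (by positivity), Finset.sum_comm]
  simp [trace, mul_apply, sq]

theorem frob_smul {m n : ℕ} (t : ℝ) (A : Matrix (Fin m) (Fin n) ℝ) :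
    frob (t • A) = |t| * frob A := by
  simp [frob, mul_pow, ← Finset.mul_sum, Real.sqrt_mul (sq_nonneg t), Real.sqrt_sq_eq_abs]

theorem trace_transpose_mul_self_nonneg {m n : ℕ} (A : Matrix (Fin m) (Fin n) ℝ) :
    0 ≤ trace (Aᵀ * A) := frob_sq A ▸ sq_nonneg _

theorem trace_transpose_mul_mul {m n : ℕ} (B : Matrix (Fin m) (Fin m) ℝ)
    (P : Matrix (Fin m) (Fin n) ℝ) :
    trace (Pᵀ * B * P) = ∑ j, P.col j ⬝ᵥ B *ᵥ P.col j := by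
  simp only [Matrix.mul_assoc]
  rfl

theorem dot_self_nonneg {k : ℕ} (w : Fin k → ℝ) : 0 ≤ w ⬝ᵥ w :=
  Finset.sum_nonneg fun i _ => mul_self_nonneg (w i)

theorem dot_self_pos {k : ℕ} {w : Fin k → ℝ} (hw : w ≠ 0) : 0 < w ⬝ᵥ w :=
  (dot_self_nonneg w).lt_of_ne' (dotProduct_self_eq_zero.not.2 hw)

/-- A quartic polynomial vanishing at `0` and nonnegative near `0` has zero linear coefficient and
nonnegative quadratic coefficient. -/
theorem quartic_coeffs_of_nonneg {a b c d δ : ℝ} (hδ : 0 < δ)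
    (h : ∀ t, |t| < δ → 0 ≤ a * t + b * t ^ 2 + c * t ^ 3 + d * t ^ 4) : a = 0 ∧ 0 ≤ b := by
  have key : ∀ g : ℝ → ℝ, Continuous g → (∀ t, 0 < t → t < δ → 0 ≤ g t) → 0 ≤ g 0 := by
    intro g hg hpos
    refine ge_of_tendsto (hg.continuousWithinAt (s := Set.Ioi 0) (x := 0)) ?_
    filter_upwards [Ioo_mem_nhdsGT hδ] with t ht using hpos t ht.1 ht.2
  have ha : 0 ≤ a := by
    have := key (fun t => a + b * t + c * t ^ 2 + d * t ^ 3) (by fun_prop) fun t ht htδ => by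
      have := h t (by rwa [abs_of_pos ht])
      refine nonneg_of_mul_nonneg_right (a := t) ?_ ht
      linarith
    simpa using this
  have ha' : 0 ≤ -a := by
    have := key (fun t => -a + b * t - c * t ^ 2 + d * t ^ 3) (by fun_prop) fun t ht htδ => by
      have := h (-t) (by rwa [abs_neg, abs_of_pos ht])
      refine nonneg_of_mul_nonneg_right (a := t) ?_ ht
      linarith
    simpa using this
  have ha0 : a = 0 := by linarith
  subst ha0
  have := key (fun t => b + c * t + d * t ^ 2) (by fun_prop) fun t ht htδ => by
    have := h t (by rwa [abs_of_pos ht])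
    refine nonneg_of_mul_nonneg_right (a := t ^ 2) ?_ (by positivity)
    linarith
  simpa using this

/-- A real symmetric matrix has a symmetric pseudo-inverse. -/
theorem exists_pseudoInverse {r : ℕ} (G : Matrix (Fin r) (Fin r) ℝ) (hG : Gᵀ = G) :
    ∃ R : Matrix (Fin r) (Fin r) ℝ, Rᵀ = R ∧ G * R * G = G ∧ R * G * R = R ∧
      trace (R * G) ≤ r := by
  have hH : G.IsHermitian := by rwa [IsHermitian, conjTranspose_eq_transpose_of_trivial]
  obtain ⟨O, l, hO, rfl⟩ : ∃ (O : Matrix (Fin r) (Fin r) ℝ) (l : Fin r → ℝ), Oᵀ * O = 1 ∧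
      G = O * diagonal l * Oᵀ := by
    refine ⟨hH.eigenvectorUnitary, hH.eigenvalues, ?_, ?_⟩
    · have := Unitary.coe_star_mul_self hH.eigenvectorUnitary
      rwa [star_eq_conjTranspose, conjTranspose_eq_transpose_of_trivial] at this
    · have := hH.spectral_theorem
      rw [Unitary.conjStarAlgAut_apply, star_eq_conjTranspose,
        conjTranspose_eq_transpose_of_trivial] at this
      exact this
  have mul : ∀ v w : Fin r → ℝ, O * diagonal v * Oᵀ * (O * diagonal w * Oᵀ) =
      O * diagonal (v * w) * Oᵀ := by
    intro v w
    calc _ = O * diagonal v * (Oᵀ * O) * diagonal w * Oᵀ := by simp only [Matrix.mul_assoc]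
      _ = _ := by rw [hO, Matrix.mul_one, Matrix.mul_assoc O, diagonal_mul_diagonal]; rfl
  refine ⟨O * diagonal l⁻¹ * Oᵀ, ?_, ?_, ?_, ?_⟩
  · simp [Matrix.mul_assoc]
  · rw [mul, mul]
    congr 3
    ext i
    simp [mul_inv_mul_cancel]
  · rw [mul, mul]
    congr 3
    ext i
    by_cases h : l i = 0 <;> simp [h]
  · rw [mul, trace_mul_comm, ← Matrix.mul_assoc, hO, Matrix.one_mul, trace_diagonal]
    calc _ ≤ ∑ _i : Fin r, (1 : ℝ) := Finset.sum_le_sum fun i _ => by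
          by_cases h : l i = 0 <;> simp [h]
      _ = r := by simp

/-- The orthogonal projection onto the row space of a matrix. -/
theorem exists_rowSpace_projection {r n : ℕ} (N : Matrix (Fin r) (Fin n) ℝ) :
    ∃ (P : Matrix (Fin n) (Fin n) ℝ) (T : Matrix (Fin r) (Fin n) ℝ), Pᵀ = P ∧ P * P = P ∧
      N * P = N ∧ P = Nᵀ * T ∧ trace P ≤ r := by
  obtain ⟨R, hRt, hGRG, hRGR, htr⟩ := exists_pseudoInverse (N * Nᵀ) (by simp)
  refine ⟨Nᵀ * (R * N), R * N, ?_, ?_, ?_, rfl, ?_⟩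
  · simp [hRt, Matrix.mul_assoc]
  · calc _ = Nᵀ * ((R * (N * Nᵀ) * R) * N) := by simp only [Matrix.mul_assoc]
      _ = _ := by rw [hRGR]
  · rw [← sub_eq_zero, ← self_mul_conjTranspose_eq_zero, conjTranspose_eq_transpose_of_trivial]
    calc _ = N * Nᵀ * R * (N * Nᵀ) * R * (N * Nᵀ) - N * Nᵀ * R * (N * Nᵀ)
          - N * Nᵀ * R * (N * Nᵀ) + N * Nᵀ := by
          simp only [transpose_sub, transpose_mul, transpose_transpose, hRt, Matrix.mul_sub,
            Matrix.sub_mul, Matrix.mul_assoc]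
          abel
      _ = 0 := by simp [hGRG]
  · rwa [trace_mul_comm, Matrix.mul_assoc]

section

variable {d0 d1 d2 n : ℕ} {X : Matrix (Fin d0) (Fin n) ℝ} {Y : Matrix (Fin d2) (Fin n) ℝ}
  {W₂ : Matrix (Fin d2) (Fin d1) ℝ} {W₁ : Matrix (Fin d1) (Fin d0) ℝ}

/-- First and second order optimality conditions along a direction `(U, V)`. -/
theorem optimality_conditions
    (hloc : ∃ ε > 0, ∀ (V₂ : Matrix (Fin d2) (Fin d1) ℝ) (V₁ : Matrix (Fin d1) (Fin d0) ℝ),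
      frob (V₂ - W₂) < ε → frob (V₁ - W₁) < ε →
        (1 / 2) * frob (W₂ * W₁ * X - Y) ^ 2 ≤ (1 / 2) * frob (V₂ * V₁ * X - Y) ^ 2)
    (U : Matrix (Fin d2) (Fin d1) ℝ) (V : Matrix (Fin d1) (Fin d0) ℝ) :
    trace ((Y - W₂ * W₁ * X)ᵀ * (U * (W₁ * X) + W₂ * (V * X))) = 0 ∧
      2 * trace ((Y - W₂ * W₁ * X)ᵀ * (U * (V * X))) ≤
        trace ((U * (W₁ * X) + W₂ * (V * X))ᵀ * (U * (W₁ * X) + W₂ * (V * X))) := by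
  obtain ⟨ε, hε, h⟩ := hloc
  set D := Y - W₂ * W₁ * X with hD
  set P := U * (W₁ * X) + W₂ * (V * X) with hP
  set Q := U * (V * X) with hQ
  have hU : 0 ≤ frob U := Real.sqrt_nonneg _
  have hV : 0 ≤ frob V := Real.sqrt_nonneg _
  have := quartic_coeffs_of_nonneg (a := -2 * trace (Dᵀ * P))
    (b := trace (Pᵀ * P) - 2 * trace (Dᵀ * Q)) (c := 2 * trace (Pᵀ * Q)) (d := trace (Qᵀ * Q))
    (δ := ε / (frob U + frob V + 1)) (by positivity) fun t ht => by
      rw [lt_div_iff₀ (by positivity)] at ht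
      have hVU := mul_nonneg (abs_nonneg t) hU
      have hVV := mul_nonneg (abs_nonneg t) hV
      have := h (W₂ + t • U) (W₁ + t • V)
        (by rw [add_sub_cancel_left, frob_smul]; nlinarith [abs_nonneg t])
        (by rw [add_sub_cancel_left, frob_smul]; nlinarith [abs_nonneg t])
      have e1 : W₂ * W₁ * X - Y = -D := by rw [hD]; abel
      have e2 : (W₂ + t • U) * (W₁ + t • V) * X - Y = t • P + t ^ 2 • Q - D := by
        rw [hD, hP, hQ]
        simp only [Matrix.add_mul, Matrix.mul_add, Matrix.smul_mul, Matrix.mul_smul, smul_add,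
          smul_smul, Matrix.mul_assoc, sq]
        abel
      rw [e1, e2, frob_sq, frob_sq] at this
      have c1 : trace (Pᵀ * D) = trace (Dᵀ * P) := by
        rw [← trace_transpose, transpose_mul, transpose_transpose]
      have c2 : trace (Qᵀ * D) = trace (Dᵀ * Q) := by
        rw [← trace_transpose, transpose_mul, transpose_transpose]
      have c3 : trace (Qᵀ * P) = trace (Pᵀ * Q) := by
        rw [← trace_transpose, transpose_mul, transpose_transpose]
      simp only [transpose_sub, transpose_add, transpose_smul, transpose_neg, Matrix.mul_sub,
        Matrix.sub_mul, Matrix.add_mul, Matrix.mul_add, Matrix.smul_mul, Matrix.mul_smul,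
        Matrix.neg_mul, Matrix.mul_neg, neg_neg, trace_sub, trace_add, trace_smul, smul_eq_mul,
        c1, c2, c3] at this
      linarith
  exact ⟨by linarith [this.1], by linarith [this.2]⟩

/-- If the residual is orthogonal to the rows of `X`, then `W₂ * W₁` solves the unconstrained
least squares problem. -/
theorem le_of_residual_mul_transpose_eq_zero
    (h : (Y - W₂ * W₁ * X) * Xᵀ = 0)
    (Z : Matrix (Fin d2) (Fin d0) ℝ) :
    frob (W₂ * W₁ * X - Y) ^ 2 ≤ frob (Z * X - Y) ^ 2 := by
  set D := Y - W₂ * W₁ * X with hD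
  have e1 : W₂ * W₁ * X - Y = -D := by rw [hD]; abel
  have e2 : Z * X - Y = (Z - W₂ * W₁) * X - D := by rw [hD, Matrix.sub_mul]; abel
  have h1 : ∀ C : Matrix (Fin d2) (Fin d0) ℝ, trace ((C * X)ᵀ * D) = 0 := fun C => by
    rw [← trace_transpose, transpose_mul, transpose_transpose, trace_mul_comm, Matrix.mul_assoc,
      show X * Dᵀ = (D * Xᵀ)ᵀ by simp, h]
    simp
  have h2 : ∀ C : Matrix (Fin d2) (Fin d0) ℝ, trace (Dᵀ * (C * X)) = 0 := fun C => by
    rw [← trace_transpose, transpose_mul, transpose_transpose, h1]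
  rw [e1, e2, frob_sq, frob_sq]
  generalize Z - W₂ * W₁ = C
  rw [transpose_sub, Matrix.mul_sub, Matrix.sub_mul, Matrix.sub_mul]
  simp only [trace_sub, h1, h2, transpose_neg, Matrix.neg_mul, Matrix.mul_neg, neg_neg]
  linarith [trace_transpose_mul_self_nonneg (C * X)]

/-- The optimality conditions along rank-one directions. -/
theorem rank_one_conditions
    (hloc : ∃ ε > 0, ∀ (V₂ : Matrix (Fin d2) (Fin d1) ℝ) (V₁ : Matrix (Fin d1) (Fin d0) ℝ),
      frob (V₂ - W₂) < ε → frob (V₁ - W₁) < ε →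
        (1 / 2) * frob (W₂ * W₁ * X - Y) ^ 2 ≤ (1 / 2) * frob (V₂ * V₁ * X - Y) ^ 2) :
    (Y - W₂ * W₁ * X) * (W₁ * X)ᵀ = 0 ∧ W₂ᵀ * (Y - W₂ * W₁ * X) * Xᵀ = 0 ∧
      ∀ (a b : Fin d1 → ℝ) (u : Fin d2 → ℝ) (v : Fin d0 → ℝ),
        (a ᵥ* (W₁ * X)) ⬝ᵥ (v ᵥ* X) = 0 →
        2 * ((a ⬝ᵥ b) * (u ⬝ᵥ (Y - W₂ * W₁ * X) *ᵥ (v ᵥ* X))) ≤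
          (u ⬝ᵥ u) * ((a ᵥ* (W₁ * X)) ⬝ᵥ (a ᵥ* (W₁ * X))) +
            (W₂ *ᵥ b ⬝ᵥ W₂ *ᵥ b) * ((v ᵥ* X) ⬝ᵥ (v ᵥ* X)) := by
  have h := optimality_conditions hloc
  set D := Y - W₂ * W₁ * X
  set A := W₁ * X
  refine ⟨?_, ?_, ?_⟩
  · rw [← trace_conjTranspose_mul_self_eq_zero_iff, conjTranspose_eq_transpose_of_trivial,
      transpose_mul, transpose_transpose, Matrix.mul_assoc, trace_mul_comm]
    simpa [Matrix.mul_assoc] using (h (D * Aᵀ) 0).1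
  · rw [← trace_conjTranspose_mul_self_eq_zero_iff, conjTranspose_eq_transpose_of_trivial,
      transpose_mul, transpose_mul, transpose_transpose, transpose_transpose, Matrix.mul_assoc,
      trace_mul_comm]
    simpa [Matrix.mul_assoc] using (h 0 (W₂ᵀ * D * Xᵀ)).1
  · intro a b u v hx
    have hx' : (v ᵥ* X) ⬝ᵥ (a ᵥ* A) = 0 := by rw [dotProduct_comm, hx]
    have := (h (vecMulVec u a) (vecMulVec b v)).2
    simp only [vecMulVec_mul, mul_vecMulVec, transpose_add, Matrix.mul_add, trace_add,
      transpose_vecMulVec, trace_vecMulVec, add_mulVec, vecMulVec_mulVec, add_dotProduct,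
      op_smul_eq_smul, smul_dotProduct, mulVec_smul, hx, hx', smul_eq_mul, mul_zero, add_zero,
      zero_add] at this
    rwa [mulVec_transpose, ← dotProduct_mulVec] at this

/-- In the nondegenerate case a constant separates the curvature of the fitted part from the
curvature of the residual. -/
theorem exists_separating_constant [NeZero d1] {A : Matrix (Fin d1) (Fin n) ℝ}
    {D : Matrix (Fin d2) (Fin n) ℝ} (hA : ∀ a, a ᵥ* A = 0 → a = 0)
    (h : ∀ (a b : Fin d1 → ℝ) (u : Fin d2 → ℝ) (v : Fin d0 → ℝ),
      (a ᵥ* A) ⬝ᵥ (v ᵥ* X) = 0 → 2 * ((a ⬝ᵥ b) * (u ⬝ᵥ D *ᵥ (v ᵥ* X))) ≤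
        (u ⬝ᵥ u) * ((a ᵥ* A) ⬝ᵥ (a ᵥ* A)) + (W₂ *ᵥ b ⬝ᵥ W₂ *ᵥ b) * ((v ᵥ* X) ⬝ᵥ (v ᵥ* X))) :
    ∃ c : ℝ, 0 ≤ c ∧
      (∀ a, c * ((a ᵥ* A) ⬝ᵥ (a ᵥ* A)) ≤ W₂ *ᵥ A *ᵥ (a ᵥ* A) ⬝ᵥ W₂ *ᵥ A *ᵥ (a ᵥ* A)) ∧
      ∀ v, A *ᵥ (v ᵥ* X) = 0 →
        D *ᵥ (v ᵥ* X) ⬝ᵥ D *ᵥ (v ᵥ* X) ≤ c * ((v ᵥ* X) ⬝ᵥ (v ᵥ* X)) := by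
  have key : ∀ a v, A *ᵥ (v ᵥ* X) = 0 →
      (D *ᵥ (v ᵥ* X) ⬝ᵥ D *ᵥ (v ᵥ* X)) * ((a ᵥ* A) ⬝ᵥ (a ᵥ* A)) ≤
      (W₂ *ᵥ A *ᵥ (a ᵥ* A) ⬝ᵥ W₂ *ᵥ A *ᵥ (a ᵥ* A)) * ((v ᵥ* X) ⬝ᵥ (v ᵥ* X)) := by
    intro a v hv
    have := h a (A *ᵥ (a ᵥ* A)) (D *ᵥ (v ᵥ* X)) v (by rw [← dotProduct_mulVec, hv, dotProduct_zero])
    rw [dotProduct_mulVec a A] at this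
    linarith
  let S : Set ℝ := {s | ∃ v, A *ᵥ (v ᵥ* X) = 0 ∧
    s = (D *ᵥ (v ᵥ* X) ⬝ᵥ D *ᵥ (v ᵥ* X)) / ((v ᵥ* X) ⬝ᵥ (v ᵥ* X))}
  have bound : ∀ a, a ᵥ* A ≠ 0 → ∀ s ∈ S, s ≤
      (W₂ *ᵥ A *ᵥ (a ᵥ* A) ⬝ᵥ W₂ *ᵥ A *ᵥ (a ᵥ* A)) / ((a ᵥ* A) ⬝ᵥ (a ᵥ* A)) := by
    rintro a ha s ⟨v, hv, rfl⟩
    by_cases hy : v ᵥ* X = 0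
    · simpa [hy] using div_nonneg (dot_self_nonneg _) (dot_self_nonneg _)
    · rw [div_le_div_iff₀ (dot_self_pos hy) (dot_self_pos ha)]
      exact key a v hv
  have zero_mem : (0 : ℝ) ∈ S := ⟨0, by simp, by simp⟩
  have bdd : BddAbove S := by
    refine ⟨_, bound (Pi.single 0 1) fun h0 => ?_⟩
    simpa using congrFun (hA _ h0) 0
  refine ⟨sSup S, le_csSup bdd zero_mem, fun a => ?_, fun v hv => ?_⟩
  · by_cases ha : a ᵥ* A = 0
    · simp [ha]
    · rw [← le_div_iff₀ (dot_self_pos ha)]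
      exact csSup_le ⟨0, zero_mem⟩ (bound a ha)
  · by_cases hy : v ᵥ* X = 0
    · simp [hy]
    · rw [← div_le_iff₀ (dot_self_pos hy)]
      exact le_csSup bdd ⟨v, hv, rfl⟩

/-- If `W₁ * X` has linearly dependent rows, the residual at a local minimum is orthogonal to the
rows of `X`. -/
theorem residual_mul_transpose_eq_zero {A : Matrix (Fin d1) (Fin n) ℝ}
    {D : Matrix (Fin d2) (Fin n) ℝ} {a : Fin d1 → ℝ} (ha : a ≠ 0) (haA : a ᵥ* A = 0)
    (h : ∀ (a b : Fin d1 → ℝ) (u : Fin d2 → ℝ) (v : Fin d0 → ℝ),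
      (a ᵥ* A) ⬝ᵥ (v ᵥ* X) = 0 → 2 * ((a ⬝ᵥ b) * (u ⬝ᵥ D *ᵥ (v ᵥ* X))) ≤
        (u ⬝ᵥ u) * ((a ᵥ* A) ⬝ᵥ (a ᵥ* A)) + (W₂ *ᵥ b ⬝ᵥ W₂ *ᵥ b) * ((v ᵥ* X) ⬝ᵥ (v ᵥ* X))) :
    D * Xᵀ = 0 := by
  rw [← mulVec_injective.eq_iff]
  ext1 v
  rw [← mulVec_mulVec, mulVec_transpose, zero_mulVec]
  set y := v ᵥ* X
  by_contra hy
  have hk := mul_pos (dot_self_pos ha) (dot_self_pos hy)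
  set k := (a ⬝ᵥ a) * (D *ᵥ y ⬝ᵥ D *ᵥ y) with hk_def
  set C := (W₂ *ᵥ a ⬝ᵥ W₂ *ᵥ a) * (y ⬝ᵥ y)
  have := h (((C + 1) / k) • a) a (D *ᵥ y) v (by simp [smul_vecMul, haA])
  simp only [smul_vecMul, haA, smul_zero, dotProduct_zero, mul_zero, zero_add, smul_dotProduct,
    smul_eq_mul, mul_assoc] at this
  rw [← hk_def, div_mul_cancel₀ _ hk.ne'] at this
  have hC : 0 ≤ C := mul_nonneg (dot_self_nonneg _) (dot_self_nonneg _)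
  linarith

/-- Eckart–Young type comparison: a stationary factorization with linearly independent rows
whose curvature is separated by a constant is optimal. -/
theorem le_of_separating_constant {A : Matrix (Fin d1) (Fin n) ℝ}
    {D : Matrix (Fin d2) (Fin n) ℝ} (hAX : A = W₁ * X) (hY : Y = W₂ * A + D)
    (hA : ∀ a, a ᵥ* A = 0 → a = 0) (hDA : D * Aᵀ = 0) (hWD : W₂ᵀ * D * Xᵀ = 0) {c : ℝ} (hc : 0 ≤ c)
    (hfit : ∀ a, c * ((a ᵥ* A) ⬝ᵥ (a ᵥ* A)) ≤ W₂ *ᵥ A *ᵥ (a ᵥ* A) ⬝ᵥ W₂ *ᵥ A *ᵥ (a ᵥ* A))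
    (hres : ∀ v, A *ᵥ (v ᵥ* X) = 0 →
      D *ᵥ (v ᵥ* X) ⬝ᵥ D *ᵥ (v ᵥ* X) ≤ c * ((v ᵥ* X) ⬝ᵥ (v ᵥ* X)))
    (V₂ : Matrix (Fin d2) (Fin d1) ℝ) (V₁ : Matrix (Fin d1) (Fin d0) ℝ) :
    trace (Dᵀ * D) ≤ trace ((V₂ * V₁ * X - Y)ᵀ * (V₂ * V₁ * X - Y)) := by
  have hdet : IsUnit (A * Aᵀ).det := by
    rw [isUnit_iff_ne_zero, Ne, ← exists_vecMul_eq_zero_iff]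
    rintro ⟨a, ha, h0⟩
    refine ha (hA a ?_)
    rwa [← conjTranspose_eq_transpose_of_trivial, vecMul_self_mul_conjTranspose_eq_zero] at h0
  set I := (A * Aᵀ)⁻¹
  have hIl : I * (A * Aᵀ) = 1 := nonsing_inv_mul _ hdet
  have hIr : A * Aᵀ * I = 1 := mul_nonsing_inv _ hdet
  set Q := Aᵀ * I * A with hQ
  have hQt : trace Q = d1 := by
    rw [hQ, Matrix.mul_assoc, trace_mul_comm, Matrix.mul_assoc, hIl]
    simp
  have hAQ : A * Q = A := by
    rw [hQ, ← Matrix.mul_assoc, ← Matrix.mul_assoc, hIr, Matrix.one_mul]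
  have hQz : ∀ z, Q *ᵥ z = (I *ᵥ A *ᵥ z) ᵥ* A := fun z => by
    rw [← mulVec_transpose, hQ, ← mulVec_mulVec, ← mulVec_mulVec]
  have hAz : ∀ z, A *ᵥ Q *ᵥ z = A *ᵥ z := fun z => by rw [mulVec_mulVec, hAQ]
  have hzQz : ∀ z, Q *ᵥ z ⬝ᵥ Q *ᵥ z = z ⬝ᵥ Q *ᵥ z := fun z => by
    conv_lhs => rw [hQz z, ← dotProduct_mulVec, ← hQz, hAz]
    rw [hQz z, dotProduct_comm z, ← dotProduct_mulVec]
  set K := (W₂ * A)ᵀ * (W₂ * A) - c • Q with hK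
  have hKz : ∀ z, z ⬝ᵥ K *ᵥ z = W₂ *ᵥ A *ᵥ z ⬝ᵥ W₂ *ᵥ A *ᵥ z - c * (z ⬝ᵥ Q *ᵥ z) := fun z => by
    rw [hK, sub_mulVec, dotProduct_sub, smul_mulVec, dotProduct_smul, ← mulVec_mulVec,
      dotProduct_mulVec, vecMul_transpose, ← mulVec_mulVec, smul_eq_mul]
  have hK0 : ∀ z, 0 ≤ z ⬝ᵥ K *ᵥ z := fun z => by
    have := hfit (I *ᵥ A *ᵥ z)
    rw [← hQz, hAz, hzQz] at this
    rw [hKz]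
    linarith
  have hYK : ∀ w, Y *ᵥ (w ᵥ* X) ⬝ᵥ Y *ᵥ (w ᵥ* X) ≤
      (w ᵥ* X) ⬝ᵥ K *ᵥ (w ᵥ* X) + c * ((w ᵥ* X) ⬝ᵥ (w ᵥ* X)) := by
    intro w
    have hcross : W₂ *ᵥ A *ᵥ (w ᵥ* X) ⬝ᵥ D *ᵥ (w ᵥ* X) = 0 := by
      rw [← vecMul_transpose, ← dotProduct_mulVec, ← mulVec_transpose X w,
        mulVec_mulVec _ W₂ᵀ D, mulVec_mulVec _ (W₂ᵀ * D) Xᵀ, hWD, zero_mulVec, dotProduct_zero]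
    set z := w ᵥ* X with hz
    have hy : (w - (I *ᵥ A *ᵥ z) ᵥ* W₁) ᵥ* X = z - Q *ᵥ z := by
      rw [sub_vecMul, vecMul_vecMul, ← hAX, ← hQz]
    have hD : D *ᵥ (z - Q *ᵥ z) = D *ᵥ z := by
      rw [mulVec_sub, mulVec_mulVec, hQ, ← Matrix.mul_assoc, ← Matrix.mul_assoc, hDA]
      simp
    have := hres (w - (I *ᵥ A *ᵥ z) ᵥ* W₁) (by rw [hy, mulVec_sub, hAz, sub_self])
    rw [hy, hD, sub_dotProduct, dotProduct_sub, dotProduct_sub, hzQz,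
      dotProduct_comm (Q *ᵥ z) z] at this
    rw [hKz, hY, add_mulVec, add_dotProduct, dotProduct_add, dotProduct_add, ← mulVec_mulVec,
      dotProduct_comm (D *ᵥ z) (W₂ *ᵥ _), hcross]
    linarith
  obtain ⟨P, T, hPt, hPP, hNP, hPT, htr⟩ := exists_rowSpace_projection (V₁ * X)
  have hcol : ∀ j, P.col j = (V₁ᵀ * T).col j ᵥ* X := fun j => by
    rw [← mulVec_transpose, hPT, transpose_mul, Matrix.mul_assoc]
    rfl
  have h1 : trace ((Y * P)ᵀ * (Y * P)) ≤ trace (P * K * P) + c * trace P := by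
    calc trace ((Y * P)ᵀ * (Y * P)) = trace (Pᵀ * (Yᵀ * Y) * P) := by
          simp only [transpose_mul, Matrix.mul_assoc]
      _ ≤ trace (Pᵀ * K * P) + c * trace (Pᵀ * 1 * P) := by
          simp only [trace_transpose_mul_mul, Finset.mul_sum, ← Finset.sum_add_distrib]
          refine Finset.sum_le_sum fun j _ => ?_
          rw [one_mulVec, hcol, ← mulVec_mulVec, dotProduct_mulVec _ Yᵀ, vecMul_transpose]
          exact hYK _
      _ = _ := by rw [hPt, Matrix.mul_one, hPP]
  have h2 : trace (P * K * P) ≤ trace K := by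
    have : 0 ≤ trace ((1 - P)ᵀ * K * (1 - P)) := by
      rw [trace_transpose_mul_mul]
      exact Finset.sum_nonneg fun j _ => hK0 _
    have e1 : trace (P * K * P) = trace (P * K) := by
      rw [trace_mul_comm, ← Matrix.mul_assoc, hPP]
    have e2 : trace (K * P) = trace (P * K) := trace_mul_comm _ _
    simp only [transpose_sub, transpose_one, hPt, Matrix.sub_mul, Matrix.mul_sub, Matrix.one_mul,
      Matrix.mul_one, trace_sub, e1, e2] at this
    linarith
  have h3 : trace K = trace ((W₂ * A)ᵀ * (W₂ * A)) - c * d1 := by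
    rw [hK, trace_sub, trace_smul, hQt, smul_eq_mul]
  have h4 : trace (Yᵀ * Y) = trace ((W₂ * A)ᵀ * (W₂ * A)) + trace (Dᵀ * D) := by
    have e1 : trace ((W₂ * A)ᵀ * D) = 0 := by
      rw [trace_mul_comm, transpose_mul, ← Matrix.mul_assoc, hDA, Matrix.zero_mul, trace_zero]
    have e2 : trace (Dᵀ * (W₂ * A)) = 0 := by
      rw [← trace_transpose, transpose_mul, transpose_transpose, e1]
    rw [hY]
    simp only [transpose_add, Matrix.add_mul, Matrix.mul_add, trace_add, e1, e2]
    ring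
  have pyth : ∀ B : Matrix (Fin d2) (Fin n) ℝ, trace (Bᵀ * B) =
      trace ((B * P)ᵀ * (B * P)) + trace ((B * (1 - P))ᵀ * (B * (1 - P))) := by
    intro B
    have e1 : trace (P * (Bᵀ * (B * P))) = trace (Bᵀ * (B * P)) := by
      rw [trace_mul_comm]
      simp only [Matrix.mul_assoc, hPP]
    have e2 : trace (P * (Bᵀ * B)) = trace (Bᵀ * (B * P)) := by
      rw [trace_mul_comm, Matrix.mul_assoc]
    simp only [transpose_mul, transpose_sub, hPt, Matrix.sub_mul, Matrix.mul_sub,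
      Matrix.mul_one, trace_sub, Matrix.mul_assoc, e1, e2]
    ring
  have h5 : (V₂ * V₁ * X - Y) * (1 - P) = -(Y * (1 - P)) := by
    have : V₂ * V₁ * X * P = V₂ * V₁ * X := by
      rw [Matrix.mul_assoc V₂, Matrix.mul_assoc V₂, hNP]
    rw [Matrix.sub_mul, Matrix.mul_sub, Matrix.mul_one, this]
    simp
  have h6 := pyth (V₂ * V₁ * X - Y)
  rw [h5, transpose_neg, Matrix.neg_mul, Matrix.mul_neg, neg_neg] at h6
  have h7 := pyth Y
  have h8 := trace_transpose_mul_self_nonneg ((V₂ * V₁ * X - Y) * P)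
  have h9 := mul_le_mul_of_nonneg_left htr hc
  linarith

end

/-- For arbitrary `X`, `Y`, every local minimum of the two-layer linear network
objective `f(W2, W1) = (1/2)·‖W2·W1·X − Y‖²` is a global minimum. -/
theorem statement_6 {d0 d1 d2 n : ℕ} (X : Matrix (Fin d0) (Fin n) ℝ)
    (Y : Matrix (Fin d2) (Fin n) ℝ)
    (W₂ : Matrix (Fin d2) (Fin d1) ℝ) (W₁ : Matrix (Fin d1) (Fin d0) ℝ)
    (hloc : ∃ ε > 0, ∀ (V₂ : Matrix (Fin d2) (Fin d1) ℝ) (V₁ : Matrix (Fin d1) (Fin d0) ℝ),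
      frob (V₂ - W₂) < ε → frob (V₁ - W₁) < ε →
        (1 / 2) * frob (W₂ * W₁ * X - Y) ^ 2 ≤ (1 / 2) * frob (V₂ * V₁ * X - Y) ^ 2) :
    ∀ (V₂ : Matrix (Fin d2) (Fin d1) ℝ) (V₁ : Matrix (Fin d1) (Fin d0) ℝ),
      (1 / 2) * frob (W₂ * W₁ * X - Y) ^ 2 ≤ (1 / 2) * frob (V₂ * V₁ * X - Y) ^ 2 := by
  obtain ⟨hDA, hWD, h⟩ := rank_one_conditions hloc
  intro V₂ V₁
  refine mul_le_mul_of_nonneg_left ?_ (by norm_num)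
  by_cases hA : ∀ a, a ᵥ* (W₁ * X) = 0 → a = 0
  · rcases Nat.eq_zero_or_pos d1 with rfl | hd
    · rw [Subsingleton.elim V₂ W₂, Subsingleton.elim V₁ W₁]
    · have : NeZero d1 := ⟨hd.ne'⟩
      obtain ⟨c, hc, hfit, hres⟩ := exists_separating_constant hA h
      have := le_of_separating_constant (Y := Y) rfl (by simp [Matrix.mul_assoc]) hA hDA hWD hc
        hfit hres V₂ V₁
      rw [frob_sq, frob_sq]
      refine le_of_eq_of_le ?_ this
      rw [← neg_sub Y, transpose_neg, Matrix.neg_mul, Matrix.mul_neg, neg_neg]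
  · push Not at hA
    obtain ⟨a, haA, ha⟩ := hA
    exact le_of_residual_mul_transpose_eq_zero (residual_mul_transpose_eq_zero ha haA h) _
end

section
/- Let W = (W_h, …, W_1) with Wᵢ ∈ ℝ^{dᵢ×d_{i−1}} be non-degenerate, i.e., rank(W_h···W_1) = min over 0 ≤ i ≤ h of dᵢ. Then the product mapping M_{h,1}(W_h, …, W_1) = W_h·W_{h−1}···W_1 is locally open at W relative to its range R_{M_{h,1}} = {Z ∈ ℝ^{d_h×d_0} : rank(Z) ≤ min over 0 ≤ i ≤ h of dᵢ}. -/
open Matrix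

/-- The product of the first `p` layer matrices: `chainProd d W p = W_{p-1} ⋯ W_1 W_0`
(so the paper's `W_i` is `W (i-1)` here, and `chainProd d W h = W_h ⋯ W_1` of the paper). -/
noncomputable def chainProd (d : ℕ → ℕ)
    (W : (i : ℕ) → Matrix (Fin (d (i + 1))) (Fin (d i)) ℝ) :
    (p : ℕ) → Matrix (Fin (d p)) (Fin (d 0)) ℝ
  | 0 => 1
  | (p + 1) => W p * chainProd d W p

open Topology

theorem Matrix.exists_left_inverse_of_rank_eq {m r : ℕ} (A : Matrix (Fin m) (Fin r) ℝ)
    (hA : A.rank = r) : ∃ L : Matrix (Fin r) (Fin m) ℝ, L * A = 1 := by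
  have hker : LinearMap.ker A.mulVecLin = ⊥ := by
    have h := A.mulVecLin.finrank_range_add_finrank_ker
    rw [Module.finrank_fin_fun] at h
    rw [Matrix.rank] at hA
    exact Submodule.finrank_eq_zero.mp (by omega)
  obtain ⟨g, hg⟩ := LinearMap.exists_leftInverse_of_injective _ hker
  refine ⟨LinearMap.toMatrix' g, ?_⟩
  rw [← Matrix.toLin'_apply'] at hg
  rw [← LinearMap.toMatrix'_toLin' A, ← LinearMap.toMatrix'_comp, hg, LinearMap.toMatrix'_id]

theorem Matrix.exists_right_inverse_of_rank_eq {r n : ℕ} (B : Matrix (Fin r) (Fin n) ℝ)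
    (hB : B.rank = r) : ∃ R : Matrix (Fin n) (Fin r) ℝ, B * R = 1 := by
  obtain ⟨L, hL⟩ := Matrix.exists_left_inverse_of_rank_eq Bᵀ (by rw [Matrix.rank_transpose, hB])
  refine ⟨Lᵀ, ?_⟩
  rw [← Matrix.transpose_inj, Matrix.transpose_mul, Matrix.transpose_transpose, hL,
    Matrix.transpose_one]

/-- A matrix of rank at most `r` is recovered from any invertible `r × r` compression of it. -/
theorem Matrix.mul_inv_compression_mul {m n r : ℕ} (Z : Matrix (Fin m) (Fin n) ℝ)
    (L : Matrix (Fin r) (Fin m) ℝ) (R : Matrix (Fin n) (Fin r) ℝ)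
    (hZ : Z.rank ≤ r) (hu : IsUnit (L * Z * R).det) :
    Z * R * ((L * Z * R)⁻¹ * (L * Z)) = Z := by
  have hle : LinearMap.range (Z * R).mulVecLin ≤ LinearMap.range Z.mulVecLin := by
    rw [Matrix.mulVecLin_mul]
    exact LinearMap.range_comp_le_range _ _
  have hrank : r ≤ (Z * R).rank := by
    have h1 := Matrix.rank_of_isUnit _ ((Matrix.isUnit_iff_isUnit_det _).mpr hu)
    rw [Matrix.mul_assoc, Fintype.card_fin] at h1
    exact h1.ge.trans (Matrix.rank_mul_le_right L (Z * R))
  have heq := Submodule.eq_of_le_of_finrank_le hle (hZ.trans hrank)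
  refine Matrix.ext_of_mulVec_single fun i => ?_
  have hmem : Z *ᵥ Pi.single i 1 ∈ LinearMap.range (Z * R).mulVecLin := by
    rw [heq]
    exact ⟨_, rfl⟩
  obtain ⟨y, hy⟩ := hmem
  rw [Matrix.mulVecLin_apply] at hy
  rw [← Matrix.mul_assoc, ← Matrix.mul_assoc, ← Matrix.mulVec_mulVec, ← hy, Matrix.mulVec_mulVec,
    Matrix.mul_assoc (Z * R * _) L, ← Matrix.mul_assoc L Z R, Matrix.mul_assoc (Z * R),
    Matrix.nonsing_inv_mul _ hu, Matrix.mul_one]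

theorem continuous_frob {m n : ℕ} :
    Continuous (frob : Matrix (Fin m) (Fin n) ℝ → ℝ) := by
  unfold frob
  fun_prop

theorem frob_zero {m n : ℕ} : frob (0 : Matrix (Fin m) (Fin n) ℝ) = 0 := by
  simp [frob]

theorem abs_apply_le_frob {m n : ℕ} (A : Matrix (Fin m) (Fin n) ℝ) (i : Fin m) (j : Fin n) :
    |A i j| ≤ frob A := by
  refine Real.abs_le_sqrt ?_
  refine le_trans ?_ (Finset.single_le_sum (f := fun i => ∑ j, (A i j) ^ 2)
    (fun _ _ => Finset.sum_nonneg fun _ _ => sq_nonneg _) (Finset.mem_univ i))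
  exact Finset.single_le_sum (f := fun j => (A i j) ^ 2)
    (fun _ _ => sq_nonneg _) (Finset.mem_univ j)

theorem exists_frob_lt_of_eventually {m n : ℕ} {P : Matrix (Fin m) (Fin n) ℝ}
    {p : Matrix (Fin m) (Fin n) ℝ → Prop} (hp : ∀ᶠ Z in 𝓝 P, p Z) :
    ∃ δ > 0, ∀ Z, frob (Z - P) < δ → p Z := by
  obtain ⟨δ, hδ, hball⟩ := Metric.eventually_nhds_iff.mp
    (show ∀ᶠ Z : Fin m → Fin n → ℝ in 𝓝 P, p Z from hp)
  refine ⟨δ, hδ, fun Z hZ => hball ((dist_pi_lt_iff hδ).mpr fun i =>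
    (dist_pi_lt_iff hδ).mpr fun j => ?_)⟩
  exact (abs_apply_le_frob (Z - P) i j).trans_lt hZ

theorem eventually_frob_sub_lt {m n m' n' : ℕ} {P : Matrix (Fin m) (Fin n) ℝ}
    {f : Matrix (Fin m) (Fin n) ℝ → Matrix (Fin m') (Fin n') ℝ} (hf : ContinuousAt f P)
    {V : Matrix (Fin m') (Fin n') ℝ} (hV : f P = V) {ε : ℝ} (hε : 0 < ε) :
    ∀ᶠ Z in 𝓝 P, frob (f Z - V) < ε := by
  have hc : ContinuousAt (fun Z => frob (f Z - V)) P :=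
    continuous_frob.continuousAt.comp (hf.sub continuousAt_const)
  refine hc.eventually_lt continuousAt_const ?_
  rwa [hV, sub_self, frob_zero]

section Chain

variable (d : ℕ → ℕ)

theorem chainProd_congr {W V : (i : ℕ) → Matrix (Fin (d (i + 1))) (Fin (d i)) ℝ} {p : ℕ}
    (hWV : ∀ i < p, W i = V i) : chainProd d W p = chainProd d V p := by
  induction p with
  | zero => rfl
  | succ p ih =>
    rw [chainProd, chainProd, ih fun i hi => hWV i (by omega), hWV p (by omega)]

theorem chainProd_add (W : (i : ℕ) → Matrix (Fin (d (i + 1))) (Fin (d i)) ℝ) (k p : ℕ) :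
    chainProd d W (k + p) =
      chainProd (fun i => d (k + i)) (fun i => W (k + i)) p * chainProd d W k := by
  induction p with
  | zero => exact (Matrix.one_mul _).symm
  | succ p ih =>
    change W (k + p) * chainProd d W (k + p) = W (k + p) * _ * _
    rw [ih, Matrix.mul_assoc]

theorem chainProd_succ_eq_mul_zero (W : (i : ℕ) → Matrix (Fin (d (i + 1))) (Fin (d i)) ℝ)
    (p : ℕ) :
    chainProd d W (p + 1) =
      chainProd (fun i => d (i + 1)) (fun i => W (i + 1)) p * W 0 := by
  induction p with
  | zero => exact (Matrix.mul_one _).trans (Matrix.one_mul _).symm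
  | succ p ih =>
    rw [chainProd, ih]
    exact (Matrix.mul_assoc _ _ _).symm

/-- A chain whose product has a left inverse is locally open: it suffices to move the last
factor. -/
theorem eventually_chainProd_of_left_inverse
    (W : (i : ℕ) → Matrix (Fin (d (i + 1))) (Fin (d i)) ℝ) (q : ℕ)
    (L : Matrix (Fin (d 0)) (Fin (d (q + 1))) ℝ) (hL : L * chainProd d W (q + 1) = 1)
    {ε : ℝ} (hε : 0 < ε) :
    ∀ᶠ A in 𝓝 (chainProd d W (q + 1)),
      ∃ V : (i : ℕ) → Matrix (Fin (d (i + 1))) (Fin (d i)) ℝ,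
        (∀ i, frob (V i - W i) < ε) ∧ chainProd d V (q + 1) = A := by
  have hev := eventually_frob_sub_lt (P := chainProd d W (q + 1))
    (f := fun A => W q + (A - chainProd d W (q + 1)) * (L * W q)) (V := W q)
    (by fun_prop) (by simp) hε
  filter_upwards [hev] with A hA
  refine ⟨Function.update W q (W q + (A - chainProd d W (q + 1)) * (L * W q)), fun i => ?_, ?_⟩
  · by_cases hi : i = q
    · subst hi
      rwa [Function.update_self]
    · rwa [Function.update_of_ne hi, sub_self, frob_zero]
  · have hq : chainProd d (Function.update W q
        (W q + (A - chainProd d W (q + 1)) * (L * W q))) q = chainProd d W q :=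
      chainProd_congr d fun i hi => Function.update_of_ne hi.ne _ _
    rw [chainProd, hq, Function.update_self, Matrix.add_mul, Matrix.mul_assoc, Matrix.mul_assoc,
      ← chainProd, hL, Matrix.mul_one, add_sub_cancel]

/-- A chain whose product has a right inverse is locally open: it suffices to move the first
factor. -/
theorem eventually_chainProd_of_right_inverse
    (W : (i : ℕ) → Matrix (Fin (d (i + 1))) (Fin (d i)) ℝ) (q : ℕ)
    (R : Matrix (Fin (d 0)) (Fin (d (q + 1))) ℝ) (hR : chainProd d W (q + 1) * R = 1)
    {ε : ℝ} (hε : 0 < ε) :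
    ∀ᶠ B in 𝓝 (chainProd d W (q + 1)),
      ∃ V : (i : ℕ) → Matrix (Fin (d (i + 1))) (Fin (d i)) ℝ,
        (∀ i, frob (V i - W i) < ε) ∧ chainProd d V (q + 1) = B := by
  have hev := eventually_frob_sub_lt (P := chainProd d W (q + 1))
    (f := fun B => W 0 + W 0 * R * (B - chainProd d W (q + 1))) (V := W 0)
    (by fun_prop) (by simp) hε
  filter_upwards [hev] with B hB
  refine ⟨Function.update W 0 (W 0 + W 0 * R * (B - chainProd d W (q + 1))), fun i => ?_, ?_⟩
  · by_cases hi : i = 0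
    · subst hi
      rwa [Function.update_self]
    · rwa [Function.update_of_ne hi, sub_self, frob_zero]
  · have hq : (fun i => Function.update W 0
        (W 0 + W 0 * R * (B - chainProd d W (q + 1))) (i + 1)) = fun i => W (i + 1) :=
      funext fun i => Function.update_of_ne (Nat.succ_ne_zero i) _ _
    rw [chainProd_succ_eq_mul_zero, hq, Function.update_self, Matrix.mul_add, Matrix.mul_assoc (W 0),
      ← Matrix.mul_assoc _ (W 0), ← chainProd_succ_eq_mul_zero, ← Matrix.mul_assoc, hR,
      Matrix.one_mul, add_sub_cancel]

theorem exists_chain_append (k : ℕ)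
    (V₁ : (i : ℕ) → Matrix (Fin (d (i + 1))) (Fin (d i)) ℝ)
    (V₂ : (i : ℕ) → Matrix (Fin (d (k + i + 1))) (Fin (d (k + i))) ℝ) :
    ∃ V : (i : ℕ) → Matrix (Fin (d (i + 1))) (Fin (d i)) ℝ,
      (∀ i < k, V i = V₁ i) ∧ ∀ i, V (k + i) = V₂ i := by
  have hex : ∀ i, ∃ M : Matrix (Fin (d (i + 1))) (Fin (d i)) ℝ,
      (i < k → M = V₁ i) ∧ ∀ j, i = k + j → M ≍ V₂ j := by
    intro i
    rcases lt_or_ge i k with hi | hi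
    · exact ⟨V₁ i, fun _ => rfl, fun j hj => by omega⟩
    · obtain ⟨j, rfl⟩ := Nat.exists_eq_add_of_le hi
      refine ⟨V₂ j, fun _ => by omega, fun j' hj => ?_⟩
      obtain rfl : j = j' := by omega
      rfl
  choose V hV₁ hV₂ using hex
  exact ⟨V, hV₁, fun i => eq_of_heq (hV₂ _ i rfl)⟩

end Chain

/-- Matrices of rank at most `r` close to `A * B` factor through `ℝ^r` with factors close to
`A` and `B`, if `A` has a left and `B` a right inverse. -/
theorem eventually_exists_mul_eq_of_rank_le {m r n : ℕ} (A : Matrix (Fin m) (Fin r) ℝ)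
    (B : Matrix (Fin r) (Fin n) ℝ) (L : Matrix (Fin r) (Fin m) ℝ) (R : Matrix (Fin n) (Fin r) ℝ)
    (hL : L * A = 1) (hR : B * R = 1)
    {p : Matrix (Fin m) (Fin r) ℝ → Prop} {q : Matrix (Fin r) (Fin n) ℝ → Prop}
    (hp : ∀ᶠ A' in 𝓝 A, p A') (hq : ∀ᶠ B' in 𝓝 B, q B') :
    ∀ᶠ Z in 𝓝 (A * B), Z.rank ≤ r → ∃ A' B', p A' ∧ q B' ∧ A' * B' = Z := by
  have hLB : L * (A * B) = B := by rw [← Matrix.mul_assoc, hL, Matrix.one_mul]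
  have hAR : A * B * R = A := by rw [Matrix.mul_assoc, hR, Matrix.mul_one]
  have hdet : ∀ᶠ Z in 𝓝 (A * B), (L * Z * R).det ≠ 0 := by
    have hc : Continuous fun Z : Matrix (Fin m) (Fin n) ℝ => (L * Z * R).det := by fun_prop
    refine hc.continuousAt.eventually_ne ?_
    rw [hLB, hR, Matrix.det_one]
    exact one_ne_zero
  have hA : Filter.Tendsto (fun Z => Z * R) (𝓝 (A * B)) (𝓝 A) := by
    have hc : Continuous fun Z : Matrix (Fin m) (Fin n) ℝ => Z * R := by fun_prop
    simpa only [hAR] using hc.tendsto (A * B)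
  have hB : Filter.Tendsto (fun Z => (L * Z * R)⁻¹ * (L * Z)) (𝓝 (A * B)) (𝓝 B) := by
    have hinv : ContinuousAt (fun Z : Matrix (Fin m) (Fin n) ℝ =>
        ((L * Z * R).det)⁻¹ • (L * Z * R).adjugate * (L * Z)) (A * B) := by
      have hd : ContinuousAt (fun Z : Matrix (Fin m) (Fin n) ℝ => ((L * Z * R).det)⁻¹) (A * B) :=
        ContinuousAt.inv₀ (Continuous.continuousAt (by fun_prop)) hdet.self_of_nhds
      have ha : Continuous fun Z : Matrix (Fin m) (Fin n) ℝ =>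
          (L * Z * R).adjugate * (L * Z) := by fun_prop
      simp only [Matrix.smul_mul]
      exact hd.smul ha.continuousAt
    simpa only [ContinuousAt, ← Ring.inverse_eq_inv', ← Matrix.inv_def, hLB, hR, inv_one,
      Matrix.one_mul] using hinv
  filter_upwards [hdet, hA.eventually hp, hB.eventually hq] with Z hu hpZ hqZ hZ
  exact ⟨_, _, hpZ, hqZ, Matrix.mul_inv_compression_mul Z L R hZ hu.isUnit⟩

/-- If `W = (W_h, …, W_1)` is non-degenerate, i.e.
`rank(W_h ⋯ W_1) = min_{0 ≤ i ≤ h} dᵢ`, then the product mapping `M_{h,1}` is locally open at `W`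
relative to its range `{Z : rank Z ≤ min_{0 ≤ i ≤ h} dᵢ}`. -/
theorem statement_9 (h : ℕ) (hh : 1 ≤ h) (d : ℕ → ℕ)
    (W : (i : ℕ) → Matrix (Fin (d (i + 1))) (Fin (d i)) ℝ)
    (hnd : (chainProd d W h).rank =
      (Finset.range (h + 1)).inf' (Finset.nonempty_range_iff.mpr (Nat.succ_ne_zero h)) d) :
    ∀ ε > 0, ∃ δ > 0, ∀ Z : Matrix (Fin (d h)) (Fin (d 0)) ℝ,
      Z.rank ≤ (Finset.range (h + 1)).inf' (Finset.nonempty_range_iff.mpr (Nat.succ_ne_zero h)) d →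
      frob (Z - chainProd d W h) < δ →
        ∃ W' : (i : ℕ) → Matrix (Fin (d (i + 1))) (Fin (d i)) ℝ,
          (∀ i < h, frob (W' i - W i) < ε) ∧ chainProd d W' h = Z := by
  intro ε hε
  obtain ⟨k, hk, hmin⟩ := Finset.exists_mem_eq_inf'
    (Finset.nonempty_range_iff.mpr (Nat.succ_ne_zero h)) d
  rw [hmin] at hnd ⊢
  obtain ⟨p, rfl⟩ := Nat.exists_eq_add_of_le (Nat.lt_succ_iff.mp (Finset.mem_range.mp hk))
  clear hmin hk
  suffices hev : ∀ᶠ Z in 𝓝 (chainProd d W (k + p)), Z.rank ≤ d k →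
      ∃ W' : (i : ℕ) → Matrix (Fin (d (i + 1))) (Fin (d i)) ℝ,
        (∀ i < k + p, frob (W' i - W i) < ε) ∧ chainProd d W' (k + p) = Z by
    obtain ⟨δ, hδ, hZ⟩ := exists_frob_lt_of_eventually hev
    exact ⟨δ, hδ, fun Z hr hd => hZ Z hd hr⟩
  rcases p with _ | p
  · obtain ⟨k, rfl⟩ := Nat.exists_eq_add_of_le' hh
    obtain ⟨R, hR⟩ := Matrix.exists_right_inverse_of_rank_eq _ hnd
    filter_upwards [eventually_chainProd_of_right_inverse d W k R hR hε] with Z ⟨V, hV, hZ⟩ _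
    exact ⟨V, fun i _ => hV i, hZ⟩
  rcases k with _ | k
  · obtain ⟨L, hL⟩ := Matrix.exists_left_inverse_of_rank_eq _ hnd
    have hev := eventually_chainProd_of_left_inverse d W (0 + p) L hL hε
    filter_upwards [hev] with Z ⟨V, hV, hZ⟩ _
    exact ⟨V, fun i _ => hV i, hZ⟩
  rw [chainProd_add] at hnd ⊢
  set A := chainProd (fun i => d (k + 1 + i)) (fun i => W (k + 1 + i)) (p + 1)
  set B := chainProd d W (k + 1)
  obtain ⟨L, hL⟩ := Matrix.exists_left_inverse_of_rank_eq A
    (le_antisymm A.rank_le_width (hnd.ge.trans (Matrix.rank_mul_le_left A B)))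
  obtain ⟨R, hR⟩ := Matrix.exists_right_inverse_of_rank_eq B
    (le_antisymm B.rank_le_height (hnd.ge.trans (Matrix.rank_mul_le_right A B)))
  have hevA := eventually_chainProd_of_left_inverse (fun i => d (k + 1 + i))
    (fun i => W (k + 1 + i)) p L hL hε
  have hevB := eventually_chainProd_of_right_inverse d W k R hR hε
  filter_upwards [eventually_exists_mul_eq_of_rank_le A B L R hL hR hevA hevB] with Z hZ hr
  obtain ⟨A', B', ⟨V₂, hV₂, hA'⟩, ⟨V₁, hV₁, hB'⟩, hmul⟩ := hZ hr
  obtain ⟨V, hVl, hVr⟩ := exists_chain_append d (k + 1) V₁ V₂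
  refine ⟨V, fun i _ => ?_, ?_⟩
  · rcases lt_or_ge i (k + 1) with hi | hi
    · rw [hVl i hi]
      exact hV₁ i
    · obtain ⟨j, rfl⟩ := Nat.exists_eq_add_of_le hi
      rw [hVr j]
      exact hV₂ j
  · rw [chainProd_add, chainProd_congr d hVl, hB', funext hVr, hA', hmul]
end
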